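/- Let Φ ∈ C_c^∞((0,∞)) and let c ∈ ℝ. Then −2πi · ∫_{(c)} Φ̃(1/2 + β) · Φ̃'(1/2 − β) dβ = 4π² ∫₀^∞ (log x) · Φ(x)² dx, where Φ̃' denotes the complex derivative of the Mellin transform Φ̃; equivalently, ∫_{−∞}^{∞} Φ̃(1/2 + c + it) · Φ̃'(1/2 − c − it) dt = 2π ∫₀^∞ (log x) · Φ(x)² dx. -/

import Mathlib

noncomputable section

open scoped Classical

open Complex Real Filter Asymptotics MeasureTheory

/-- The Mellin transform `Φ̃(s) = ∫₀^∞ Φ(x) x^{s-1} dx` at a complex point `s`. -/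
def mellinC (Φ : ℝ → ℝ) (s : ℂ) : ℂ := ∫ x in Set.Ioi (0:ℝ), (Φ x : ℂ) * (x : ℂ) ^ (s - 1)

/-- The vertical-line integral `∫_{(c)} g(s) ds = i ∫_ℝ g(c + it) dt`. -/
def vertInt (g : ℂ → ℂ) (c : ℝ) : ℂ := Complex.I * ∫ t : ℝ, g ((c : ℂ) + (t : ℂ) * Complex.I)

open scoped ContDiff SchwartzMap FourierTransform

/-- A smooth, compactly supported function on `ℝ` which vanishes on `(-∞, 0]`
(its topological support may contain `0`). -/
structure IsHalfLineTest (φ : ℝ → ℂ) : Prop where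
  contDiff : ContDiff ℝ ∞ φ
  hasCompactSupport : HasCompactSupport φ
  eq_zero : ∀ x ≤ 0, φ x = 0

namespace IsHalfLineTest

variable {φ : ℝ → ℂ}

theorem deriv (hφ : IsHalfLineTest φ) : IsHalfLineTest (deriv φ) where
  contDiff := hφ.contDiff.iterate_deriv 1
  hasCompactSupport := hφ.hasCompactSupport.deriv
  eq_zero := by
    have hcont : Continuous (_root_.deriv φ) := hφ.contDiff.continuous_deriv (by simp)
    have hclosed : IsClosed {x | _root_.deriv φ x = 0} := isClosed_eq hcont continuous_const
    have hsub : Set.Iio (0 : ℝ) ⊆ {x | _root_.deriv φ x = 0} := by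
      intro x hx
      have : φ =ᶠ[nhds x] fun _ => 0 := by
        filter_upwards [Iio_mem_nhds hx] with y hy using hφ.eq_zero y (le_of_lt hy)
      simpa using this.deriv_eq
    have := closure_minimal hsub hclosed
    rw [closure_Iio] at this
    exact fun x hx => this hx

theorem euler (hφ : IsHalfLineTest φ) (a : ℝ) :
    IsHalfLineTest (fun x => (-a) • φ x - x • _root_.deriv φ x) where
  contDiff := (hφ.contDiff.const_smul (-a)).sub
    (ContDiff.fun_smul contDiff_id hφ.deriv.contDiff)
  hasCompactSupport := by
    have h1 : HasCompactSupport (fun x => (-a) • φ x) :=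
      hφ.hasCompactSupport.smul_left (f := fun _ => -a)
    have h2 : HasCompactSupport (fun x : ℝ => x • _root_.deriv φ x) :=
      hφ.deriv.hasCompactSupport.smul_left (f := fun x : ℝ => x)
    exact h1.sub h2
  eq_zero x hx := by simp [hφ.eq_zero x hx, hφ.deriv.eq_zero x hx]

theorem exists_norm_le_pow (n : ℕ) (hφ : IsHalfLineTest φ) :
    ∃ C, 0 ≤ C ∧ ∀ x, ‖φ x‖ ≤ C * |x| ^ n := by
  induction n generalizing φ with
  | zero =>
    obtain ⟨C, hC⟩ := hφ.contDiff.continuous.bounded_above_of_compact_support hφ.hasCompactSupport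
    exact ⟨C, (norm_nonneg _).trans (hC 0), by simpa using hC⟩
  | succ n ih =>
    obtain ⟨C, hC0, hC⟩ := ih hφ.deriv
    refine ⟨C, hC0, fun x => ?_⟩
    have := Convex.norm_image_sub_le_of_norm_deriv_le (f := φ) (s := Set.uIcc 0 x) (x := 0) (y := x)
      (C := C * |x| ^ n) (fun y _ => (hφ.contDiff.differentiable (by simp)) y)
      (fun y hy => (hC y).trans ?_) (convex_uIcc 0 x) Set.left_mem_uIcc Set.right_mem_uIcc
    · simpa [hφ.eq_zero 0 le_rfl, pow_succ, mul_assoc] using this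
    · have : |y| ≤ |x| := by simpa using Set.abs_sub_left_of_mem_uIcc hy
      gcongr

theorem exists_rpow_mul_norm_le (hφ : IsHalfLineTest φ) (a : ℝ) :
    ∃ C, ∀ x, 0 < x → x ^ a * ‖φ x‖ ≤ C := by
  obtain ⟨C, hC0, hC⟩ := hφ.exists_norm_le_pow ⌈-a⌉₊
  obtain ⟨R, hR⟩ := hφ.hasCompactSupport.isCompact.isBounded.subset_closedBall 0
  have hn : 0 ≤ a + (⌈-a⌉₊ : ℝ) := by linarith [Nat.le_ceil (-a)]
  refine ⟨C * (max R 0) ^ (a + (⌈-a⌉₊ : ℝ)), fun x hx => ?_⟩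
  by_cases hxR : x ≤ R
  · calc x ^ a * ‖φ x‖ ≤ x ^ a * (C * |x| ^ ⌈-a⌉₊) := by gcongr; exact hC x
      _ = C * x ^ (a + (⌈-a⌉₊ : ℝ)) := by
        rw [abs_of_pos hx, Real.rpow_add hx, Real.rpow_natCast]; ring
      _ ≤ _ := by gcongr; exact hxR.trans (le_max_left _ _)
  · have : φ x = 0 := by
      by_contra h
      have := hR (subset_tsupport _ h)
      rw [mem_closedBall_zero_iff, Real.norm_eq_abs, abs_of_pos hx] at this
      exact hxR this
    rw [this]
    simp only [norm_zero, mul_zero]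
    positivity

theorem isBigO_rpow (hφ : IsHalfLineTest φ) (a : ℝ) {l : Filter ℝ} (hl : ∀ᶠ x in l, 0 < x) :
    φ =O[l] (· ^ (-a)) := by
  obtain ⟨C, hC⟩ := hφ.exists_rpow_mul_norm_le a
  refine IsBigO.of_bound C ?_
  filter_upwards [hl] with x hx
  have hpos := Real.rpow_pos_of_pos hx a
  rw [Real.norm_of_nonneg (by positivity), Real.rpow_neg hx.le, ← div_eq_mul_inv, le_div_iff₀ hpos,
    mul_comm]
  exact hC x hx

theorem hasDerivAt_mellin (hφ : IsHalfLineTest φ) (s : ℂ) :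
    HasDerivAt (mellin φ) (mellin (fun t => Real.log t • φ t) s) s :=
  (mellin_hasDerivAt_of_isBigO_rpow (a := s.re + 1) (b := s.re - 1)
    (hφ.contDiff.continuous.locallyIntegrable.locallyIntegrableOn _)
    (hφ.isBigO_rpow _ (eventually_gt_atTop 0)) (by linarith)
    (hφ.isBigO_rpow _ self_mem_nhdsWithin) (by linarith)).2

theorem exists_abs_pow_mul_norm_le (hφ : IsHalfLineTest φ) (a : ℝ) (k : ℕ) :
    ∃ C, ∀ u : ℝ, |u| ^ k * ‖Real.exp (-a * u) • φ (Real.exp (-u))‖ ≤ C := by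
  obtain ⟨C₁, h₁⟩ := hφ.exists_rpow_mul_norm_le (a - 1)
  obtain ⟨C₂, h₂⟩ := hφ.exists_rpow_mul_norm_le (a + 1)
  refine ⟨k.factorial * (C₁ + C₂), fun u => ?_⟩
  have e₁ := h₁ _ (Real.exp_pos (-u))
  have e₂ := h₂ _ (Real.exp_pos (-u))
  rw [← Real.exp_mul] at e₁ e₂
  have hk : |u| ^ k ≤ k.factorial * (Real.exp u + Real.exp (-u)) := by
    have := Real.pow_div_factorial_le_exp |u| (abs_nonneg u) k
    rw [div_le_iff₀ (by positivity), mul_comm] at this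
    refine this.trans ?_
    gcongr
    rcases abs_cases u with ⟨h, _⟩ | ⟨h, _⟩ <;> rw [h] <;>
      linarith [Real.exp_pos u, Real.exp_pos (-u)]
  rw [norm_smul, Real.norm_of_nonneg (Real.exp_pos _).le]
  calc |u| ^ k * (Real.exp (-a * u) * ‖φ (Real.exp (-u))‖)
      ≤ k.factorial * (Real.exp u + Real.exp (-u)) *
          (Real.exp (-a * u) * ‖φ (Real.exp (-u))‖) := by gcongr
    _ = k.factorial * (Real.exp (-u * (a - 1)) * ‖φ (Real.exp (-u))‖ +
          Real.exp (-u * (a + 1)) * ‖φ (Real.exp (-u))‖) := by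
        rw [show -u * (a - 1) = u + -a * u by ring, show -u * (a + 1) = -u + -a * u by ring,
          Real.exp_add, Real.exp_add]
        ring
    _ ≤ _ := by gcongr

theorem deriv_exp_smul_comp (hφ : IsHalfLineTest φ) (a : ℝ) :
    _root_.deriv (fun u : ℝ => Real.exp (-a * u) • φ (Real.exp (-u))) =
      fun u => Real.exp (-a * u) •
        (fun x => (-a) • φ x - x • _root_.deriv φ x) (Real.exp (-u)) := by
  funext u
  have h1 : HasDerivAt (fun u : ℝ => Real.exp (-a * u)) (Real.exp (-a * u) * (-a * 1)) u :=
    ((hasDerivAt_id u).const_mul (-a)).exp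
  have h2 : HasDerivAt (fun u : ℝ => Real.exp (-u)) (Real.exp (-u) * (-1)) u :=
    (hasDerivAt_neg u).exp
  have h3 : HasDerivAt φ (_root_.deriv φ (Real.exp (-u))) (Real.exp (-u)) :=
    ((hφ.contDiff.differentiable (by simp)) _).hasDerivAt
  have h4 : HasDerivAt (fun u : ℝ => φ (Real.exp (-u))) _ u := h3.scomp u h2
  rw [(h1.fun_smul h4).deriv]
  simp only [Complex.real_smul]
  push_cast
  ring

theorem exists_iteratedDeriv_eq (n : ℕ) (hφ : IsHalfLineTest φ) (a : ℝ) :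
    ∃ ψ, IsHalfLineTest ψ ∧ iteratedDeriv n (fun u : ℝ => Real.exp (-a * u) • φ (Real.exp (-u))) =
      fun u => Real.exp (-a * u) • ψ (Real.exp (-u)) := by
  induction n generalizing φ with
  | zero => exact ⟨φ, hφ, iteratedDeriv_zero⟩
  | succ n ih =>
    rw [iteratedDeriv_succ', hφ.deriv_exp_smul_comp]
    exact ih (hφ.euler a)

/-- The Schwartz function `u ↦ e^{-au} φ(e^{-u})`, whose Fourier transform is, up to scaling, the
Mellin transform of `φ` on the line of real part `a`. -/
def toSchwartz (hφ : IsHalfLineTest φ) (a : ℝ) : 𝓢(ℝ, ℂ) where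
  toFun u := Real.exp (-a * u) • φ (Real.exp (-u))
  smooth' := (Real.contDiff_exp.comp (contDiff_const.mul contDiff_id)).smul
    (hφ.contDiff.comp (Real.contDiff_exp.comp contDiff_neg))
  decay' k n := by
    obtain ⟨ψ, hψ, h⟩ := hφ.exists_iteratedDeriv_eq n a
    obtain ⟨C, hC⟩ := hψ.exists_abs_pow_mul_norm_le a k
    refine ⟨C, fun u => ?_⟩
    rw [norm_iteratedFDeriv_eq_norm_iteratedDeriv, h]
    exact hC u

@[simp]
theorem toSchwartz_apply (hφ : IsHalfLineTest φ) (a u : ℝ) :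
    hφ.toSchwartz a u = Real.exp (-a * u) • φ (Real.exp (-u)) := rfl

theorem mellin_eq (hφ : IsHalfLineTest φ) (s : ℂ) :
    mellin φ s = 𝓕 (hφ.toSchwartz s.re) (s.im / (2 * π)) := by
  rw [mellin_eq_fourier, SchwartzMap.fourier_coe]
  rfl

theorem mellin_log_eq (hφ : IsHalfLineTest φ) (s : ℂ) :
    mellin (fun t => Real.log t • φ t) s =
      𝓕 (SchwartzMap.smulLeftCLM ℂ (fun u : ℝ => -u) (hφ.toSchwartz s.re))
        (s.im / (2 * π)) := by
  rw [mellin_eq_fourier, SchwartzMap.fourier_coe]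
  refine congrArg (fun F : ℝ → ℂ => 𝓕 F (s.im / (2 * π))) (funext fun u => ?_)
  rw [SchwartzMap.smulLeftCLM_apply_apply (by fun_prop), Real.log_exp, toSchwartz_apply, smul_comm]

theorem integral_eq_mellin_log_sq (φ : ℝ → ℂ) :
    ∫ u : ℝ, Real.exp (-u) • (-u) • φ (Real.exp (-u)) ^ 2 =
      ∫ x in Set.Ioi (0 : ℝ), Real.log x • φ x ^ 2 := by
  have h := mellin_eq_fourier (fun x => Real.log x • φ x ^ 2) (s := 1)
  simpa [mellin, Real.fourier_eq] using h.symm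

/-- Parseval's formula for the Mellin transform of a test function and its derivative. -/
theorem integral_mellin_mul_deriv_mellin (hφ : IsHalfLineTest φ) (σ : ℝ) :
    ∫ t : ℝ, mellin φ (σ + t * I) * _root_.deriv (mellin φ) (1 - σ - t * I) =
      2 * π * ∫ x in Set.Ioi (0 : ℝ), Real.log x • φ x ^ 2 := by
  set g := hφ.toSchwartz σ
  set h := SchwartzMap.smulLeftCLM ℂ (fun u : ℝ => -u) (hφ.toSchwartz (1 - σ)) with hh
  have key (t : ℝ) : mellin φ (σ + t * I) * _root_.deriv (mellin φ) (1 - σ - t * I) =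
      (fun w => 𝓕 g w * 𝓕⁻ h w) (t / (2 * π)) := by
    rw [(hφ.hasDerivAt_mellin _).deriv, hφ.mellin_eq, hφ.mellin_log_eq]
    simp [g, hh, SchwartzMap.fourierInv_coe, SchwartzMap.fourier_coe,
      Real.fourierInv_eq_fourier_neg, neg_div]
  simp_rw [key]
  rw [Measure.integral_comp_div (fun w => 𝓕 g w * 𝓕⁻ h w), SchwartzMap.integral_fourier_mul_eq,
    FourierTransform.fourier_fourierInv_eq, ← integral_eq_mellin_log_sq,
    abs_of_pos (by positivity), Complex.real_smul]
  push_cast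
  congr 2
  funext u
  rw [hh, SchwartzMap.smulLeftCLM_apply_apply (by fun_prop), toSchwartz_apply, toSchwartz_apply,
    show -u = -σ * u + -(1 - σ) * u by ring, Real.exp_add]
  simp only [Complex.real_smul]
  push_cast
  ring

end IsHalfLineTest

/-- `-2πi ∫_{(c)} Φ̃(1/2+β) Φ̃'(1/2-β) dβ = 4π² ∫₀^∞ (log x) Φ(x)² dx`, equivalently
`∫_ℝ Φ̃(1/2+c+it) Φ̃'(1/2-c-it) dt = 2π ∫₀^∞ (log x) Φ(x)² dx`. -/
theorem mellin_parseval_log (Φ : ℝ → ℝ) (hΦ : ContDiff ℝ (⊤ : ℕ∞) Φ) (hΦc : HasCompactSupport Φ)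
    (hΦsupp : Function.support Φ ⊆ Set.Ioi 0) (c : ℝ) :
    (-2 * (π : ℂ) * Complex.I *
        vertInt (fun β => mellinC Φ (1 / 2 + β) * deriv (mellinC Φ) (1 / 2 - β)) c =
      ((4 * π ^ 2 * ∫ x in Set.Ioi (0:ℝ), Real.log x * Φ x ^ 2 : ℝ) : ℂ)) ∧
    ((∫ t : ℝ, mellinC Φ (1 / 2 + (c : ℂ) + (t : ℂ) * Complex.I) *
          deriv (mellinC Φ) (1 / 2 - (c : ℂ) - (t : ℂ) * Complex.I)) =
      ((2 * π * ∫ x in Set.Ioi (0:ℝ), Real.log x * Φ x ^ 2 : ℝ) : ℂ)) := by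
  have hφ : IsHalfLineTest (fun x => (Φ x : ℂ)) := by
    refine ⟨Complex.ofRealCLM.contDiff.comp hΦ, hΦc.comp_left Complex.ofReal_zero, fun x hx => ?_⟩
    by_contra h
    exact absurd (hΦsupp (show Φ x ≠ 0 by simpa using h)) (not_lt.mpr hx)
  have hM : mellinC Φ = mellin (fun x => (Φ x : ℂ)) := by
    funext s
    simp only [mellinC, mellin, smul_eq_mul, mul_comm]
  have hI : (∫ t : ℝ, mellinC Φ (1 / 2 + (c : ℂ) + (t : ℂ) * Complex.I) *
      deriv (mellinC Φ) (1 / 2 - (c : ℂ) - (t : ℂ) * Complex.I)) =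
      ((2 * π * ∫ x in Set.Ioi (0:ℝ), Real.log x * Φ x ^ 2 : ℝ) : ℂ) := by
    have h := hφ.integral_mellin_mul_deriv_mellin (1 / 2 + c)
    rw [← hM] at h
    convert h using 1
    · congr 1
      funext t
      congr 2 <;> push_cast <;> ring
    · rw [Complex.ofReal_mul, ← integral_complex_ofReal]
      push_cast
      simp only [Complex.real_smul]
  refine ⟨?_, hI⟩
  have hV : vertInt (fun β => mellinC Φ (1 / 2 + β) * deriv (mellinC Φ) (1 / 2 - β)) c =
      Complex.I * ((2 * π * ∫ x in Set.Ioi (0:ℝ), Real.log x * Φ x ^ 2 : ℝ) : ℂ) := by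
    rw [vertInt, ← hI]
    simp only [add_assoc, sub_sub]
  rw [hV]
  push_cast
  linear_combination (-4 * (π : ℂ) ^ 2 *
    ((∫ x in Set.Ioi (0:ℝ), Real.log x * Φ x ^ 2 : ℝ) : ℂ)) * Complex.I_mul_I
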